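/- Let C_0 ≥ 0. Suppose the hyperplanes in 𝒜 are pairwise non-parallel and ‖F(A)‖ > C_0 for every A ∈ 𝒜. Fix k with 1 ≤ k ≤ n and δ_k ∈ (0, 1/2]. Let r be the minimal positive integer such that |S_t| > C_0/|S_k| for all t ≥ r, and suppose r ≤ k−1. Define U = ∑_{F_1 ⊆ {1,…,r−1}, ‖F_1‖ ≤ C_0/|S_k|} ∑_{F_2 ⊆ {1,…,r−1}, ‖F_2‖ ≤ C_0/|S_k|} ∏_{j ∈ F_1 ∪ F_2} 1/((1−δ_j)|S_j|) and V = ∑_{F_1 ⊆ {1,…,r−1}, ‖F_1‖ ≤ C_0/|S_k|} ∑_{F_2 ⊆ {1,…,r−1}, ‖F_2‖ > C_0/|S_k|} ∏_{j ∈ F_1 ∪ F_2} 1/((1−δ_j)|S_j|). Then w_k(B_k) ≤ (1/(4 δ_k (1−δ_k) |S_k|²)) · ( ∏_{j=1}^{k−1} (1 + 3/((1−δ_j)|S_j|)) − 2(U+V) ∏_{j=r}^{k−1} (1 + 1/((1−δ_j)|S_j|)) + U ). -/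

import Mathlib

open Finset
open scoped Classical

/-- A hyperplane in `S_1 × ⋯ × S_n`.  Coordinates are 0-indexed in Lean:
coordinate `j : ℕ`, `j < n`, corresponds to the paper's coordinate `j + 1`,
so the paper's set `S_j` is `S (j - 1)` here.  A hyperplane is recorded by its
finite set `F` of fixed coordinates together with the fixed value at each
fixed coordinate (on the non-fixed coordinates it is all of `S j`). -/
structure Hyp (S : ℕ → Type) (n : ℕ) where
  F : Finset ℕ
  hF : ∀ j ∈ F, j < n
  val : ∀ j ∈ F, S j

/-- The stage of a hyperplane: in the paper's 1-based labelling,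
`A.stage = max F(A)`; in the 0-based labelling it is `(sup of A.F) + 1`. -/
def Hyp.stage {S : ℕ → Type} {n : ℕ} (A : Hyp S n) : ℕ := A.F.sup id + 1

/-- `Qp S k` is the paper's `Q_k = S_1 × ⋯ × S_k` (in 0-based indexing,
`S 0 × ⋯ × S (k-1)`).  `Qp S 0` is a one-element type. -/
abbrev Qp (S : ℕ → Type) (k : ℕ) := ∀ j : Fin k, S j

/-- `x ∈ Q_k` lies on (the projection to `Q_k` of) the hyperplane `A`;
this is the correct notion of membership whenever `F(A) ⊆ {1, …, k}`. -/
def memH {S : ℕ → Type} {n : ℕ} (A : Hyp S n) {k : ℕ} (x : Qp S k) : Prop :=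
  ∀ (j : Fin k) (h : (j : ℕ) ∈ A.F), x j = A.val j h

/-- Membership in `B_k = ⋃_{A ∈ 𝒜_k} A`, viewed as a subset of `Q_k`, where
`𝒜_k = {A ∈ 𝒜 : max F(A) = k}` (1-based `k`). -/
def memB {S : ℕ → Type} {n : ℕ} {ι : Type} (𝓐 : ι → Hyp S n) (k : ℕ) (x : Qp S k) : Prop :=
  ∃ i, (𝓐 i).stage = k ∧ memH (𝓐 i) x

/-- `alpha 𝓐 k x` is the paper's `α_{k+1}(x)` for `x ∈ Q_k`: the proportion of
the fiber `F_x` covered by `B_{k+1}`. -/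
noncomputable def alpha {S : ℕ → Type} [∀ j, Fintype (S j)] {n : ℕ} {ι : Type}
    (𝓐 : ι → Hyp S n) (k : ℕ) (x : Qp S k) : ℝ :=
  ((univ.filter fun y : S k => memB 𝓐 (k + 1) (Fin.snoc x y)).card : ℝ) /
    (Fintype.card (S k))

/-- The weights `w_k : Q_k → ℝ`, defined inductively:  `w_0 ≡ 1`, and `w_(k+1)`
is obtained from `w_k` by the distortion rule with parameter `δ_{k+1} = δ k`.
(The paper's `δ_j` is `δ (j - 1)` here.) -/
noncomputable def w {S : ℕ → Type} [∀ j, Fintype (S j)] {n : ℕ} {ι : Type}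
    (𝓐 : ι → Hyp S n) (δ : ℕ → ℝ) : (k : ℕ) → Qp S k → ℝ
  | 0, _ => 1
  | (k + 1), x =>
      let x' : Qp S k := fun j => x j.castSucc
      let a : ℝ := alpha 𝓐 k x'
      if memB 𝓐 (k + 1) x then
        if a ≤ δ k then 0
        else ((a - δ k) / (a * (1 - δ k))) * (w 𝓐 δ k x' / (Fintype.card (S k)))
      else
        if a ≤ δ k then (1 / (1 - a)) * (w 𝓐 δ k x' / (Fintype.card (S k)))
        else (1 / (1 - δ k)) * (w 𝓐 δ k x' / (Fintype.card (S k)))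

/-- `w_k(B_k)` (1-based `k`). -/
noncomputable def wB {S : ℕ → Type} [∀ j, Fintype (S j)] {n : ℕ} {ι : Type}
    (𝓐 : ι → Hyp S n) (δ : ℕ → ℝ) (k : ℕ) : ℝ :=
  ∑ x ∈ univ.filter (memB 𝓐 k), w 𝓐 δ k x

/-- `w_k(A)`: the weight of the projection to `Q_k` of a hyperplane `A`
(meaningful when `F(A) ⊆ {1, …, k}`). -/
noncomputable def wH {S : ℕ → Type} [∀ j, Fintype (S j)] {n : ℕ} {ι : Type}
    (𝓐 : ι → Hyp S n) (δ : ℕ → ℝ) (k : ℕ) (A : Hyp S n) : ℝ :=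
  ∑ x ∈ univ.filter (fun x : Qp S k => memH A x), w 𝓐 δ k x

/-- `ν(J) = ∏_{j ∈ J} 1 / ((1 - δ_j)|S_j|)` (0-based `J`). -/
noncomputable def nu (S : ℕ → Type) [∀ j, Fintype (S j)] (δ : ℕ → ℝ) (J : Finset ℕ) : ℝ :=
  ∏ j ∈ J, 1 / ((1 - δ j) * (Fintype.card (S j)))

/-- `‖J‖ = ∏_{j ∈ J} |S_j|` (0-based `J`). -/
noncomputable def normJ (S : ℕ → Type) [∀ j, Fintype (S j)] (J : Finset ℕ) : ℝ :=
  ∏ j ∈ J, (Fintype.card (S j) : ℝ)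

/-- `Ew 𝓐 δ k` is the paper's `E_k = E_{(k+1)-1} = ∑_{x ∈ Q_k} α_{k+1}(x)² w_k(x)`. -/
noncomputable def Ew {S : ℕ → Type} [∀ j, Fintype (S j)] {n : ℕ} {ι : Type}
    (𝓐 : ι → Hyp S n) (δ : ℕ → ℝ) (k : ℕ) : ℝ :=
  ∑ x : Qp S k, (alpha 𝓐 k x) ^ 2 * w 𝓐 δ k x

section SubsetSums

variable {ι R : Type*} [DecidableEq ι] [CommRing R]

/-- Summing `∏ f` over the union of all pairs of subsets of `T`. -/
lemma sum_powerset_sum_powerset_prod_union (f : ι → R) (T : Finset ι) :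
    ∑ F₁ ∈ T.powerset, ∑ F₂ ∈ T.powerset, ∏ j ∈ F₁ ∪ F₂, f j = ∏ j ∈ T, (1 + 3 * f j) := by
  induction T using Finset.induction_on with
  | empty => simp
  | insert a T ha ih =>
    have key : ∀ F₁ ∈ T.powerset, ∀ F₂ ∈ T.powerset, a ∉ F₁ ∪ F₂ := by
      intro F₁ h₁ F₂ h₂ h
      rw [mem_powerset] at h₁ h₂
      exact ha (union_subset h₁ h₂ h)
    have h₁ : ∑ F₁ ∈ T.powerset, ∑ F₂ ∈ T.powerset, ∏ j ∈ F₁ ∪ insert a F₂, f j =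
        f a * ∑ F₁ ∈ T.powerset, ∑ F₂ ∈ T.powerset, ∏ j ∈ F₁ ∪ F₂, f j := by
      simp_rw [mul_sum]
      refine sum_congr rfl fun F₁ h₁ => sum_congr rfl fun F₂ h₂ => ?_
      rw [union_insert, prod_insert (key F₁ h₁ F₂ h₂)]
    have h₂ : ∑ F₁ ∈ T.powerset, ∑ F₂ ∈ T.powerset, ∏ j ∈ insert a F₁ ∪ F₂, f j =
        f a * ∑ F₁ ∈ T.powerset, ∑ F₂ ∈ T.powerset, ∏ j ∈ F₁ ∪ F₂, f j := by
      simp_rw [mul_sum]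
      refine sum_congr rfl fun F₁ h₁ => sum_congr rfl fun F₂ h₂ => ?_
      rw [insert_union, prod_insert (key F₁ h₁ F₂ h₂)]
    have h₃ : ∑ F₁ ∈ T.powerset, ∑ F₂ ∈ T.powerset, ∏ j ∈ insert a F₁ ∪ insert a F₂, f j =
        f a * ∑ F₁ ∈ T.powerset, ∑ F₂ ∈ T.powerset, ∏ j ∈ F₁ ∪ F₂, f j := by
      simp_rw [mul_sum]
      refine sum_congr rfl fun F₁ h₁ => sum_congr rfl fun F₂ h₂ => ?_
      rw [← insert_union_distrib, prod_insert (key F₁ h₁ F₂ h₂)]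
    simp_rw [sum_powerset_insert ha, sum_add_distrib]
    rw [h₁, h₂, h₃, ih, prod_insert ha]
    ring

/-- Coordinates of `T` disjoint from `A` and `F` factor out of the sum over subsets of `A ∪ T`. -/
lemma sum_powerset_union_prod_union (f : ι → R) {F A T : Finset ι}
    (hF : Disjoint F T) (hA : Disjoint A T) :
    ∑ G ∈ (A ∪ T).powerset, ∏ j ∈ F ∪ G, f j =
      (∑ G ∈ A.powerset, ∏ j ∈ F ∪ G, f j) * ∏ j ∈ T, (1 + f j) := by
  induction T using Finset.induction_on with
  | empty => simp
  | insert a T ha ih =>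
    rw [disjoint_insert_right] at hF hA
    have haT : a ∉ A ∪ T := by simp [hA.1, ha]
    have h : ∑ G ∈ (A ∪ T).powerset, ∏ j ∈ F ∪ insert a G, f j =
        f a * ∑ G ∈ (A ∪ T).powerset, ∏ j ∈ F ∪ G, f j := by
      rw [mul_sum]
      refine sum_congr rfl fun G hG => ?_
      rw [union_insert, prod_insert]
      rw [mem_powerset] at hG
      rw [mem_union, not_or]
      exact ⟨hF.1, fun h => haT (hG h)⟩
    rw [union_insert, sum_powerset_insert haT, h, ih hF.2 hA.2, prod_insert ha]
    ring

/-- Inclusion–exclusion for pairs of subsets both failing a predicate `p`. -/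
lemma sum_filter_not_sum_filter_not_prod_union (f : ι → R)
    (P : Finset (Finset ι)) (p : Finset ι → Prop) :
    ∑ F₁ ∈ P with ¬ p F₁, ∑ F₂ ∈ P with ¬ p F₂, ∏ j ∈ F₁ ∪ F₂, f j =
      ∑ F₁ ∈ P, ∑ F₂ ∈ P, ∏ j ∈ F₁ ∪ F₂, f j -
        2 * ∑ F₁ ∈ P with p F₁, ∑ F₂ ∈ P, ∏ j ∈ F₁ ∪ F₂, f j +
        ∑ F₁ ∈ P with p F₁, ∑ F₂ ∈ P with p F₂, ∏ j ∈ F₁ ∪ F₂, f j := by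
  have hcomm : ∑ F₁ ∈ P with ¬ p F₁, ∑ F₂ ∈ P with p F₂, ∏ j ∈ F₁ ∪ F₂, f j =
      ∑ F₁ ∈ P with p F₁, ∑ F₂ ∈ P with ¬ p F₂, ∏ j ∈ F₁ ∪ F₂, f j := by
    rw [sum_comm]
    simp_rw [union_comm]
  have hsplit : ∀ F₁, ∑ F₂ ∈ P, ∏ j ∈ F₁ ∪ F₂, f j =
      ∑ F₂ ∈ P with p F₂, ∏ j ∈ F₁ ∪ F₂, f j + ∑ F₂ ∈ P with ¬ p F₂, ∏ j ∈ F₁ ∪ F₂, f j :=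
    fun F₁ => (sum_filter_add_sum_filter_not P p _).symm
  rw [← sum_filter_add_sum_filter_not P p fun F₁ => ∑ F₂ ∈ P, ∏ j ∈ F₁ ∪ F₂, f j]
  simp_rw [hsplit, sum_add_distrib]
  rw [hcomm]
  ring

end SubsetSums

section Stage

variable {S : ℕ → Type} {n : ℕ}

lemma mem_F_of_stage_eq {A : Hyp S n} (hne : A.F.Nonempty) {k : ℕ} (h : A.stage = k + 1) :
    k ∈ A.F := by
  obtain ⟨j, hj, hjs⟩ := exists_mem_eq_sup A.F hne id
  rw [Hyp.stage, hjs] at h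
  simp only [id, Nat.add_right_cancel_iff] at h
  exact h ▸ hj

lemma le_of_stage_eq {A : Hyp S n} {k : ℕ} (h : A.stage = k + 1) {j : ℕ} (hj : j ∈ A.F) :
    j ≤ k := by
  have : id j ≤ A.F.sup id := le_sup hj
  rw [Hyp.stage] at h
  simp only [id] at this
  omega

end Stage

section Weights

variable {S : ℕ → Type} [∀ j, Fintype (S j)] {n : ℕ} {ι : Type} {𝓐 : ι → Hyp S n} {δ : ℕ → ℝ}

lemma w_snoc (k : ℕ) (x : Qp S k) (y : S k) :
    w 𝓐 δ (k + 1) (Fin.snoc x y) =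
      if memB 𝓐 (k + 1) (Fin.snoc x y) then
        if alpha 𝓐 k x ≤ δ k then 0
        else ((alpha 𝓐 k x - δ k) / (alpha 𝓐 k x * (1 - δ k))) *
          (w 𝓐 δ k x / (Fintype.card (S k)))
      else
        if alpha 𝓐 k x ≤ δ k then
          (1 / (1 - alpha 𝓐 k x)) * (w 𝓐 δ k x / (Fintype.card (S k)))
        else (1 / (1 - δ k)) * (w 𝓐 δ k x / (Fintype.card (S k))) := by
  have h : (fun j : Fin k => (Fin.snoc x y : Qp S (k + 1)) j.castSucc) = x := by
    funext j
    exact Fin.snoc_castSucc (α := fun j : Fin (k + 1) => S j) y x j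
  rw [w]
  simp only [h]

lemma sum_Qp_succ (k : ℕ) (g : Qp S (k + 1) → ℝ) :
    ∑ x, g x = ∑ x : Qp S k, ∑ y : S k, g (Fin.snoc x y) := by
  rw [← (Fin.snocEquiv fun j : Fin (k + 1) => S j).sum_comp g, Fintype.sum_prod_type_right]
  rfl

lemma alpha_nonneg (k : ℕ) (x : Qp S k) : 0 ≤ alpha 𝓐 k x := by
  unfold alpha
  positivity

lemma card_fiber_eq (k : ℕ) (x : Qp S k) (hS : 0 < Fintype.card (S k)) :
    ((univ.filter fun y : S k => memB 𝓐 (k + 1) (Fin.snoc x y)).card : ℝ) =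
      alpha 𝓐 k x * Fintype.card (S k) := by
  have : (0 : ℝ) < Fintype.card (S k) := by exact_mod_cast hS
  unfold alpha
  field_simp

lemma sum_ite_memB (k : ℕ) (x : Qp S k) (hS : 0 < Fintype.card (S k)) (a b : ℝ) :
    ∑ y : S k, (if memB 𝓐 (k + 1) (Fin.snoc x y) then a else b) =
      (alpha 𝓐 k x * a + (1 - alpha 𝓐 k x) * b) * Fintype.card (S k) := by
  have hc := card_filter_add_card_filter_not (s := (univ : Finset (S k)))
    fun y => memB 𝓐 (k + 1) (Fin.snoc x y)
  have hc' : ((univ.filter fun y : S k => memB 𝓐 (k + 1) (Fin.snoc x y)).card : ℝ) +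
      ((univ.filter fun y : S k => ¬ memB 𝓐 (k + 1) (Fin.snoc x y)).card : ℝ) =
      Fintype.card (S k) := by
    exact_mod_cast hc
  rw [card_fiber_eq k x hS] at hc'
  rw [sum_ite, sum_const, sum_const, nsmul_eq_mul, nsmul_eq_mul, card_fiber_eq k x hS]
  linear_combination b * hc'

lemma w_nonneg (hδ : ∀ j, j < n → δ j ∈ Set.Icc (0 : ℝ) (1 / 2)) :
    ∀ k ≤ n, ∀ x : Qp S k, 0 ≤ w 𝓐 δ k x := by
  intro k
  induction k with
  | zero => intro _ x; simp [w]
  | succ k ih =>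
    intro hk x
    obtain ⟨h₀, h₁⟩ := hδ k hk
    have hw := ih (by omega) fun j => x j.castSucc
    have ha := alpha_nonneg (𝓐 := 𝓐) k fun j => x j.castSucc
    have hδ' : 0 < 1 - δ k := by linarith
    rw [w]
    split_ifs with hB h h
    · exact le_rfl
    · have : 0 ≤ alpha 𝓐 k (fun j => x j.castSucc) - δ k := by linarith
      positivity
    · have : 0 ≤ 1 - alpha 𝓐 k (fun j => x j.castSucc) := by linarith
      positivity
    · positivity

/-- The distortion rule preserves the total mass of each fibre. -/
lemma sum_w_snoc (k : ℕ) (hδ : δ k ∈ Set.Icc (0 : ℝ) (1 / 2)) (hS : 0 < Fintype.card (S k))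
    (x : Qp S k) : ∑ y : S k, w 𝓐 δ (k + 1) (Fin.snoc x y) = w 𝓐 δ k x := by
  obtain ⟨h₀, h₁⟩ := hδ
  have hδ' : 1 - δ k ≠ 0 := by linarith
  have hS' : (Fintype.card (S k) : ℝ) ≠ 0 := by exact_mod_cast hS.ne'
  rw [sum_congr rfl fun y _ => w_snoc k x y, sum_ite_memB k x hS]
  split_ifs with h
  · have : 1 - alpha 𝓐 k x ≠ 0 := by linarith
    field_simp
    ring
  · have : alpha 𝓐 k x ≠ 0 := by linarith
    field_simp
    ring

lemma w_snoc_le (k : ℕ) (hδ : δ k ∈ Set.Icc (0 : ℝ) (1 / 2)) (x : Qp S k)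
    (hw : 0 ≤ w 𝓐 δ k x) (y : S k) :
    w 𝓐 δ (k + 1) (Fin.snoc x y) ≤ w 𝓐 δ k x * (1 / ((1 - δ k) * Fintype.card (S k))) := by
  obtain ⟨h₀, h₁⟩ := hδ
  have hδ' : 0 < 1 - δ k := by linarith
  have hr : w 𝓐 δ k x * (1 / ((1 - δ k) * Fintype.card (S k))) =
      1 / (1 - δ k) * (w 𝓐 δ k x / Fintype.card (S k)) := by
    field_simp
  rw [w_snoc, hr]
  split_ifs with hB h h
  · positivity
  · have ha : 0 < alpha 𝓐 k x := by linarith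
    refine mul_le_mul_of_nonneg_right ?_ (by positivity)
    rw [div_le_div_iff₀ (by positivity) hδ']
    nlinarith
  · refine mul_le_mul_of_nonneg_right ?_ (by positivity)
    exact one_div_le_one_div_of_le hδ' (by linarith)
  · exact le_rfl

/-- The weight of the subcube of `Q_k` through `z` with coordinates in `J` fixed is at most
`ν(J ∩ {1, …, k})`. -/
lemma sum_w_subcube_le (hcard : ∀ j, j < n → 0 < Fintype.card (S j))
    (hδ : ∀ j, j < n → δ j ∈ Set.Icc (0 : ℝ) (1 / 2)) (J : Finset ℕ) :
    ∀ k ≤ n, ∀ z : Qp S k,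
      ∑ x, (if ∀ j : Fin k, (j : ℕ) ∈ J → x j = z j then w 𝓐 δ k x else 0) ≤
        ∏ j ∈ range k, if j ∈ J then 1 / ((1 - δ j) * (Fintype.card (S j) : ℝ)) else 1 := by
  intro k
  induction k with
  | zero => intro _ z; simp [w]
  | succ k ih =>
    intro hk z
    have hδ' : 0 < 1 - δ k := by linarith [(hδ k hk).2]
    have hw := w_nonneg (𝓐 := 𝓐) hδ
    have hcond : ∀ (x : Qp S k) (y : S k),
        (∀ j : Fin (k + 1), (j : ℕ) ∈ J → (Fin.snoc x y : Qp S (k + 1)) j = z j) ↔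
          (∀ j : Fin k, (j : ℕ) ∈ J → x j = z j.castSucc) ∧ (k ∈ J → y = z (Fin.last k)) := by
      intro x y
      rw [Fin.forall_fin_succ']
      refine and_congr (forall_congr' fun j => ?_) ?_
      · rw [Fin.snoc_castSucc (α := fun j : Fin (k + 1) => S j) y x j]; rfl
      · rw [Fin.snoc_last (α := fun j : Fin (k + 1) => S j) y x]; rfl
    set b : ℝ := if k ∈ J then 1 / ((1 - δ k) * (Fintype.card (S k) : ℝ)) else 1 with hb
    have hb₀ : 0 ≤ b := by rw [hb]; split_ifs <;> positivity
    rw [sum_Qp_succ, prod_range_succ]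
    refine le_trans ?_ (mul_le_mul_of_nonneg_right (ih (by omega) fun j => z j.castSucc) hb₀)
    rw [sum_mul]
    refine sum_le_sum fun x _ => ?_
    by_cases hx : ∀ j : Fin k, (j : ℕ) ∈ J → x j = z j.castSucc
    · rw [if_pos hx,
        sum_congr rfl fun y _ => if_congr ((hcond x y).trans (and_iff_right hx)) rfl rfl]
      by_cases hkJ : k ∈ J
      · simp only [hkJ, true_imp_iff, if_true, sum_ite_eq', mem_univ]
        simpa using w_snoc_le k (hδ k hk) x (hw k (by omega) x) (z (Fin.last k))
      · simp only [hkJ, false_imp_iff, if_true, if_false, mul_one]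
        exact (sum_w_snoc k (hδ k hk) (hcard k hk) x).le
    · rw [if_neg hx, zero_mul]
      exact (sum_eq_zero fun y _ => if_neg fun h => hx ((hcond x y).1 h).1).le

lemma sum_w_memH_inter_le (hcard : ∀ j, j < n → 0 < Fintype.card (S j))
    (hδ : ∀ j, j < n → δ j ∈ Set.Icc (0 : ℝ) (1 / 2)) {k : ℕ} (hk : k ≤ n) (A A' : Hyp S n) :
    ∑ x : Qp S k, (if memH A x ∧ memH A' x then w 𝓐 δ k x else 0) ≤
      nu S δ (range k ∩ (A.F ∪ A'.F)) := by
  have hw := w_nonneg (𝓐 := 𝓐) hδ k hk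
  rw [nu, ← prod_ite_mem]
  by_cases hz : ∃ z : Qp S k, memH A z ∧ memH A' z
  · obtain ⟨z, hz, hz'⟩ := hz
    refine le_trans (sum_le_sum fun x _ => ?_)
      (sum_w_subcube_le (𝓐 := 𝓐) hcard hδ (A.F ∪ A'.F) k hk z)
    by_cases hx : memH A x ∧ memH A' x
    · rw [if_pos hx, if_pos]
      intro j hj
      rcases mem_union.1 hj with hj | hj
      · rw [hx.1 j hj, hz j hj]
      · rw [hx.2 j hj, hz' j hj]
    · rw [if_neg hx]
      split_ifs
      exacts [hw x, le_rfl]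
  · push Not at hz
    rw [sum_eq_zero fun x _ => if_neg fun hx => hz x hx.1 hx.2]
    refine prod_nonneg fun j hj => ?_
    have : 0 < 1 - δ j := by linarith [(hδ j ((mem_range.1 hj).trans_le hk)).2]
    split_ifs <;> positivity

lemma wB_succ_le_Ew (hδ : ∀ j, j < n → δ j ∈ Set.Icc (0 : ℝ) (1 / 2)) {k : ℕ} (hk : k < n)
    (hδk : 0 < δ k) (hS : 0 < Fintype.card (S k)) :
    wB 𝓐 δ (k + 1) ≤ 1 / (4 * δ k * (1 - δ k)) * Ew 𝓐 δ k := by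
  have hδ' : 0 < 1 - δ k := by linarith [(hδ k hk).2]
  have hS' : (0 : ℝ) < Fintype.card (S k) := by exact_mod_cast hS
  rw [wB, sum_filter, sum_Qp_succ, Ew, mul_sum]
  refine sum_le_sum fun x _ => ?_
  have hw := w_nonneg (𝓐 := 𝓐) hδ k hk.le x
  have hrw : ∀ y : S k, (if memB 𝓐 (k + 1) (Fin.snoc x y : Qp S (k + 1)) then
      w 𝓐 δ (k + 1) (Fin.snoc x y) else 0) =
      if memB 𝓐 (k + 1) (Fin.snoc x y : Qp S (k + 1)) then
        if alpha 𝓐 k x ≤ δ k then 0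
        else ((alpha 𝓐 k x - δ k) / (alpha 𝓐 k x * (1 - δ k))) *
          (w 𝓐 δ k x / (Fintype.card (S k)))
      else 0 := by
    intro y
    rw [w_snoc]
    split_ifs <;> rfl
  simp_rw [hrw]
  rw [sum_ite_memB k x hS]
  split_ifs with h
  · simp only [mul_zero, add_zero, zero_mul]
    positivity
  · have ha : 0 < alpha 𝓐 k x := by linarith
    have he : (alpha 𝓐 k x * ((alpha 𝓐 k x - δ k) / (alpha 𝓐 k x * (1 - δ k)) *
        (w 𝓐 δ k x / Fintype.card (S k))) + (1 - alpha 𝓐 k x) * 0) * Fintype.card (S k) =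
        1 / (4 * δ k * (1 - δ k)) * ((4 * δ k * (alpha 𝓐 k x - δ k)) * w 𝓐 δ k x) := by
      field_simp
      ring
    rw [he]
    refine mul_le_mul_of_nonneg_left (mul_le_mul_of_nonneg_right ?_ hw) (by positivity)
    nlinarith [sq_nonneg (alpha 𝓐 k x - 2 * δ k)]

variable [Fintype ι]

lemma alpha_le (hFne : ∀ i, (𝓐 i).F.Nonempty) (k : ℕ) (x : Qp S k) :
    alpha 𝓐 k x ≤
      (∑ i with (𝓐 i).stage = k + 1, if memH (𝓐 i) x then (1 : ℝ) else 0) /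
        Fintype.card (S k) := by
  rw [alpha, sum_boole, filter_filter]
  gcongr
  refine card_le_card_of_forall_subsingleton
    (fun y i => memH (𝓐 i) (Fin.snoc x y : Qp S (k + 1))) ?_ ?_
  · intro y hy
    obtain ⟨i, hi, hm⟩ := (mem_filter.1 hy).2
    refine ⟨i, mem_filter.2 ⟨mem_univ _, hi, fun j hj => ?_⟩, hm⟩
    have := hm j.castSucc hj
    rwa [Fin.snoc_castSucc (α := fun j : Fin (k + 1) => S j) y x j] at this
  · intro i hi y hy y' hy'
    have hkF := mem_F_of_stage_eq (hFne i) (mem_filter.1 hi).2.1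
    have h := hy.2 (Fin.last k) hkF
    have h' := hy'.2 (Fin.last k) hkF
    rw [Fin.snoc_last (α := fun j : Fin (k + 1) => S j)] at h h'
    exact h.trans h'.symm

lemma Ew_le_sum_nu (hcard : ∀ j, j < n → 0 < Fintype.card (S j))
    (hδ : ∀ j, j < n → δ j ∈ Set.Icc (0 : ℝ) (1 / 2)) (hFne : ∀ i, (𝓐 i).F.Nonempty)
    {k : ℕ} (hk : k ≤ n) :
    Ew 𝓐 δ k ≤ 1 / (Fintype.card (S k) : ℝ) ^ 2 *
      ∑ i with (𝓐 i).stage = k + 1, ∑ i' with (𝓐 i').stage = k + 1,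
        nu S δ (range k ∩ ((𝓐 i).F ∪ (𝓐 i').F)) := by
  have hpt : ∀ x : Qp S k, alpha 𝓐 k x ^ 2 * w 𝓐 δ k x ≤ 1 / (Fintype.card (S k) : ℝ) ^ 2 *
      ∑ i with (𝓐 i).stage = k + 1, ∑ i' with (𝓐 i').stage = k + 1,
        if memH (𝓐 i) x ∧ memH (𝓐 i') x then w 𝓐 δ k x else 0 := by
    intro x
    have hw := w_nonneg (𝓐 := 𝓐) hδ k hk x
    have h := pow_le_pow_left₀ (alpha_nonneg k x) (alpha_le hFne k x) 2
    refine (mul_le_mul_of_nonneg_right h hw).trans_eq ?_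
    rw [div_pow, sq (∑ i with _, _), sum_mul_sum, div_mul_eq_mul_div, div_eq_mul_one_div,
      mul_comm _ (1 / _), sum_mul]
    simp_rw [sum_mul]
    congr 1
    refine sum_congr rfl fun i _ => sum_congr rfl fun i' _ => ?_
    by_cases h₁ : memH (𝓐 i) x <;> by_cases h₂ : memH (𝓐 i') x <;> simp [h₁, h₂]
  refine (sum_le_sum fun x _ => hpt x).trans ?_
  rw [← mul_sum, sum_comm]
  refine mul_le_mul_of_nonneg_left (sum_le_sum fun i _ => ?_) (by positivity)
  rw [sum_comm]
  exact sum_le_sum fun i' _ => sum_w_memH_inter_le hcard hδ hk _ _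

/-- The second moment is bounded by a sum over pairs of index sets, using that the traces on
`{1, …, k - 1}` of non-parallel hyperplanes of stage `k` are distinct. -/
lemma Ew_le_sum_subsets (hcard : ∀ j, j < n → 0 < Fintype.card (S j))
    (hδ : ∀ j, j < n → δ j ∈ Set.Icc (0 : ℝ) (1 / 2)) (hFne : ∀ i, (𝓐 i).F.Nonempty)
    (hpar : ∀ i i', (𝓐 i).F = (𝓐 i').F → i = i') {C₀ : ℝ}
    (hnorm : ∀ i, C₀ < normJ S (𝓐 i).F) {k : ℕ} (hk : k < n) :
    Ew 𝓐 δ k ≤ 1 / (Fintype.card (S k) : ℝ) ^ 2 *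
      ∑ F₁ ∈ (range k).powerset with ¬ normJ S F₁ ≤ C₀ / Fintype.card (S k),
        ∑ F₂ ∈ (range k).powerset with ¬ normJ S F₂ ≤ C₀ / Fintype.card (S k),
          nu S δ (F₁ ∪ F₂) := by
  have hS : (0 : ℝ) < Fintype.card (S k) := by exact_mod_cast hcard k hk
  refine (Ew_le_sum_nu hcard hδ hFne hk.le).trans
    (mul_le_mul_of_nonneg_left ?_ (by positivity))
  set I : Finset ι := univ.filter fun i => (𝓐 i).stage = k + 1 with hI
  have hins : ∀ i ∈ I, insert k (range k ∩ (𝓐 i).F) = (𝓐 i).F := by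
    intro i hi
    have hs := (mem_filter.1 hi).2
    ext j
    simp only [mem_insert, mem_inter, mem_range]
    constructor
    · rintro (rfl | h)
      exacts [mem_F_of_stage_eq (hFne i) hs, h.2]
    · intro hj
      rcases (le_of_stage_eq hs hj).eq_or_lt with h | h
      exacts [Or.inl h, Or.inr ⟨h, hj⟩]
  have hinj : Set.InjOn (fun i => range k ∩ (𝓐 i).F) I := by
    intro i hi i' hi' h
    apply hpar
    rw [← hins i hi, ← hins i' hi']
    exact congrArg (insert k) h
  have hsub : I.image (fun i => range k ∩ (𝓐 i).F) ⊆
      (range k).powerset.filter fun F => ¬ normJ S F ≤ C₀ / Fintype.card (S k) := by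
    intro F hF
    obtain ⟨i, hi, rfl⟩ := mem_image.1 hF
    refine mem_filter.2 ⟨mem_powerset.2 inter_subset_left, ?_⟩
    have h := hnorm i
    rw [← hins i hi, normJ, prod_insert (by simp)] at h
    rw [not_le, div_lt_iff₀' hS]
    exact h
  have hnu : ∀ F₁ ∈ (range k).powerset, ∀ F₂ ∈ (range k).powerset, 0 ≤ nu S δ (F₁ ∪ F₂) := by
    intro F₁ h₁ F₂ h₂
    refine prod_nonneg fun j hj => ?_
    have hj' := mem_range.1 (union_subset (mem_powerset.1 h₁) (mem_powerset.1 h₂) hj)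
    have : 0 < 1 - δ j := by linarith [(hδ j (hj'.trans hk)).2]
    positivity
  simp_rw [inter_union_distrib_left]
  rw [← sum_image (f := fun F₁ => ∑ i' ∈ I, nu S δ (F₁ ∪ range k ∩ (𝓐 i').F)) hinj]
  have himg : ∀ F₁, ∑ i' ∈ I, nu S δ (F₁ ∪ range k ∩ (𝓐 i').F) =
      ∑ F₂ ∈ I.image fun i => range k ∩ (𝓐 i).F, nu S δ (F₁ ∪ F₂) :=
    fun F₁ => (sum_image (f := fun F₂ => nu S δ (F₁ ∪ F₂)) hinj).symm
  simp_rw [himg]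
  refine (sum_le_sum fun F₁ h₁ => ?_).trans (sum_le_sum_of_subset_of_nonneg hsub fun F₁ h₁ _ => ?_)
  · exact sum_le_sum_of_subset_of_nonneg hsub fun F₂ h₂ _ =>
      hnu F₁ (mem_filter.1 (hsub h₁)).1 F₂ (mem_filter.1 h₂).1
  · exact sum_nonneg fun F₂ h₂ => hnu F₁ (mem_filter.1 h₁).1 F₂ (mem_filter.1 h₂).1

end Weights

lemma card_le_normJ {S : ℕ → Type} [∀ j, Fintype (S j)] {F : Finset ℕ}
    (hF : ∀ j ∈ F, 0 < Fintype.card (S j)) {j : ℕ} (hj : j ∈ F) :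
    (Fintype.card (S j) : ℝ) ≤ normJ S F := by
  rw [normJ, ← Nat.cast_prod]
  exact_mod_cast Nat.le_of_dvd (prod_pos hF) (dvd_prod_of_mem _ hj)

/-- **Corollary (computational form).**  Let `C₀ ≥ 0`, suppose the hyperplanes
of `𝒜` are pairwise non-parallel with `‖F(A)‖ > C₀` for every `A ∈ 𝒜`, fix
`1 ≤ k ≤ n` (the paper's `k` is `k + 1` here, `k < n`) with `δ_k ∈ (0, 1/2]`,
and let `r` (1-based) be the minimal positive integer with `|S_t| > C₀/|S_k|`
for all `t ≥ r`; suppose `r ≤ k - 1` (i.e. `r ≤ k` for our 0-based `k`).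
With `U` and `V` as in the paper (the paper's `{1, …, r - 1}` is
`Finset.range (r - 1)` here),
`w_k(B_k) ≤ (1/(4 δ_k (1 - δ_k)|S_k|²)) ⬝ (∏_{j=1}^{k-1} (1 + 3/((1-δ_j)|S_j|))
  − 2 (U + V) ∏_{j=r}^{k-1} (1 + 1/((1-δ_j)|S_j|)) + U)`. -/
theorem wB_le_UV_form
    (S : ℕ → Type) [∀ j, Fintype (S j)] (n : ℕ) (hn : 0 < n)
    (hcard : ∀ j, j < n → 2 ≤ Fintype.card (S j))
    (δ : ℕ → ℝ) (hδ : ∀ j, j < n → δ j ∈ Set.Icc (0 : ℝ) (1 / 2))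
    (ι : Type) [Fintype ι] (𝓐 : ι → Hyp S n)
    (hFne : ∀ i, (𝓐 i).F.Nonempty)
    (hpar : ∀ i i', (𝓐 i).F = (𝓐 i').F → i = i')
    (C₀ : ℝ) (hC₀ : 0 ≤ C₀)
    (hnorm : ∀ i, C₀ < normJ S (𝓐 i).F)
    (k : ℕ) (hk : k < n) (hδk : 0 < δ k)
    (r : ℕ) (hr0 : 0 < r)
    (hrall : ∀ t, r ≤ t → t ≤ n → C₀ / (Fintype.card (S k)) < (Fintype.card (S (t - 1)) : ℝ))
    (hrmin : ∀ r', 0 < r' →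
      (∀ t, r' ≤ t → t ≤ n → C₀ / (Fintype.card (S k)) < (Fintype.card (S (t - 1)) : ℝ)) →
      r ≤ r')
    (hrk : r ≤ k) :
    letI U : ℝ :=
      ∑ F₁ ∈ (Finset.range (r - 1)).powerset.filter
          (fun J => normJ S J ≤ C₀ / (Fintype.card (S k))),
        ∑ F₂ ∈ (Finset.range (r - 1)).powerset.filter
            (fun J => normJ S J ≤ C₀ / (Fintype.card (S k))),
          ∏ j ∈ F₁ ∪ F₂, 1 / ((1 - δ j) * (Fintype.card (S j)))
    letI V : ℝ :=
      ∑ F₁ ∈ (Finset.range (r - 1)).powerset.filter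
          (fun J => normJ S J ≤ C₀ / (Fintype.card (S k))),
        ∑ F₂ ∈ (Finset.range (r - 1)).powerset.filter
            (fun J => C₀ / (Fintype.card (S k)) < normJ S J),
          ∏ j ∈ F₁ ∪ F₂, 1 / ((1 - δ j) * (Fintype.card (S j)))
    wB 𝓐 δ (k + 1) ≤ (1 / (4 * δ k * (1 - δ k) * (Fintype.card (S k) : ℝ) ^ 2)) *
      ((∏ j ∈ Finset.range k, (1 + 3 / ((1 - δ j) * (Fintype.card (S j))))) -
        2 * (U + V) *
          (∏ j ∈ Finset.Ico (r - 1) k, (1 + 1 / ((1 - δ j) * (Fintype.card (S j))))) +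
        U) := by
  set U : ℝ :=
    ∑ F₁ ∈ (range (r - 1)).powerset.filter
        (fun J => normJ S J ≤ C₀ / (Fintype.card (S k))),
      ∑ F₂ ∈ (range (r - 1)).powerset.filter
          (fun J => normJ S J ≤ C₀ / (Fintype.card (S k))),
        ∏ j ∈ F₁ ∪ F₂, 1 / ((1 - δ j) * (Fintype.card (S j))) with hU
  set V : ℝ :=
    ∑ F₁ ∈ (range (r - 1)).powerset.filter
        (fun J => normJ S J ≤ C₀ / (Fintype.card (S k))),
      ∑ F₂ ∈ (range (r - 1)).powerset.filter
          (fun J => C₀ / (Fintype.card (S k)) < normJ S J),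
        ∏ j ∈ F₁ ∪ F₂, 1 / ((1 - δ j) * (Fintype.card (S j))) with hV
  have hpos : ∀ j, j < n → 0 < Fintype.card (S j) := fun j hj => by linarith [hcard j hj]
  have hδ' : 0 < 1 - δ k := by linarith [(hδ k hk).2]
  set c : ℝ := C₀ / Fintype.card (S k)
  set f : ℕ → ℝ := fun j => 1 / ((1 - δ j) * (Fintype.card (S j))) with hf
  have hsmall : (range k).powerset.filter (fun J => normJ S J ≤ c) =
      (range (r - 1)).powerset.filter fun J => normJ S J ≤ c := by
    ext F
    simp only [mem_filter, mem_powerset, and_congr_left_iff]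
    intro hFc
    refine ⟨fun hF j hj => ?_, fun hF => hF.trans (range_subset_range.2 (by omega))⟩
    by_contra hjr
    rw [mem_range] at hjr
    have hjk := mem_range.1 (hF hj)
    have h := hrall (j + 1) (by omega) (by omega)
    have h' := card_le_normJ (fun i hi => hpos i ((mem_range.1 (hF hi)).trans hk)) hj
    rw [Nat.add_sub_cancel] at h
    linarith
  have hUV : U + V = ∑ F₁ ∈ (range (r - 1)).powerset with normJ S F₁ ≤ c,
      ∑ F₂ ∈ (range (r - 1)).powerset, ∏ j ∈ F₁ ∪ F₂, f j := by
    rw [hU, hV, ← sum_add_distrib]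
    refine sum_congr rfl fun F₁ _ => ?_
    simp_rw [← not_le]
    exact sum_filter_add_sum_filter_not _ _ _
  have hrange : range k = range (r - 1) ∪ Ico (r - 1) k := by
    rw [range_eq_Ico, range_eq_Ico, Ico_union_Ico_eq_Ico (Nat.zero_le _) (by omega)]
  have hdisj : Disjoint (range (r - 1)) (Ico (r - 1) k) := by
    rw [range_eq_Ico]
    exact Ico_disjoint_Ico_consecutive _ _ _
  have hmixed : ∑ F₁ ∈ (range k).powerset with normJ S F₁ ≤ c,
      ∑ F₂ ∈ (range k).powerset, ∏ j ∈ F₁ ∪ F₂, f j =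
      (U + V) * ∏ j ∈ Ico (r - 1) k, (1 + f j) := by
    rw [hsmall, hUV, sum_mul]
    refine sum_congr rfl fun F₁ h₁ => ?_
    rw [hrange]
    exact sum_powerset_union_prod_union f
      (disjoint_of_subset_left (mem_powerset.1 (mem_filter.1 h₁).1) hdisj) hdisj
  have hprod : ∏ j ∈ range k, (1 + 3 / ((1 - δ j) * (Fintype.card (S j) : ℝ))) =
      ∏ j ∈ range k, (1 + 3 * f j) := by
    refine prod_congr rfl fun j _ => ?_
    rw [hf, mul_one_div]
  calc wB 𝓐 δ (k + 1) ≤ 1 / (4 * δ k * (1 - δ k)) * Ew 𝓐 δ k :=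
        wB_succ_le_Ew hδ hk hδk (hpos k hk)
    _ ≤ 1 / (4 * δ k * (1 - δ k)) * (1 / (Fintype.card (S k) : ℝ) ^ 2 *
        ∑ F₁ ∈ (range k).powerset with ¬ normJ S F₁ ≤ c,
          ∑ F₂ ∈ (range k).powerset with ¬ normJ S F₂ ≤ c, nu S δ (F₁ ∪ F₂)) :=
        mul_le_mul_of_nonneg_left (Ew_le_sum_subsets hpos hδ hFne hpar hnorm hk) (by positivity)
    _ = _ := by
        simp only [nu]
        rw [sum_filter_not_sum_filter_not_prod_union f, sum_powerset_sum_powerset_prod_union,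
          hmixed, hsmall, hprod, ← mul_assoc, one_div_mul_one_div, ← mul_assoc 2]
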